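/- arXiv:0905.2091 — 6 statements merged into one kernel-verified Lean document; each statement's English description precedes it below -/
import Mathlib

section
/- Let m, n ≥ 1, let A ∈ ℂ^{m×m}, let B^{(x)} ∈ ℂ^{n×n} for x ∈ Fin m, and let U ∈ ℂ^{n×n} be an invertible matrix whose columns u_j satisfy B^{(x)} u_j = λ^{(x)}_j u_j for all x ∈ Fin m, j ∈ Fin n. Let à be the lifted matrix Ã((x,c),(y,d)) = δ_{c,d}·A_{x,y} + δ_{x,y}·B^{(x)}_{c,d}, and for j ∈ Fin n let V_j ⊆ ℂ^{Fin m × Fin n} be the linear span of the vectors v_x^{(j)} (x ∈ Fin m) with v_x^{(j)}(y,d) = δ_{x,y}·u_j(d). Then each V_j is an invariant subspace of à (Ã maps V_j into V_j), each V_j has dimension m, the subspaces V_j are independent, and ℂ^{Fin m × Fin n} is the (internal) direct sum of V_1, …, V_n. -/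
open scoped BigOperators

/-- The lifted matrix `Ã((x,c),(y,d)) = δ_{c,d}·A_{x,y} + δ_{x,y}·B^{(x)}_{c,d}`. -/
def liftedMatrix {m n : ℕ} (A : Matrix (Fin m) (Fin m) ℂ)
    (B : Fin m → Matrix (Fin n) (Fin n) ℂ) :
    Matrix (Fin m × Fin n) (Fin m × Fin n) ℂ :=
  Matrix.of fun p q =>
    (if p.2 = q.2 then A p.1 q.1 else 0) + (if p.1 = q.1 then B p.1 p.2 q.2 else 0)

/-- The vector `v_x^{(j)}(y,d) = δ_{x,y}·u_j(d)`, placing `u_j` in the `x`-th block. -/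
def blockVec {m n : ℕ} (u : Fin n → ℂ) (x : Fin m) : Fin m × Fin n → ℂ :=
  fun p => if x = p.1 then u p.2 else 0

theorem mem_span_blockVec_iff {m n : ℕ} (u : Fin n → ℂ) (w : Fin m × Fin n → ℂ) :
    w ∈ Submodule.span ℂ (Set.range fun x : Fin m => blockVec u x) ↔
      ∃ a : Fin m → ℂ, ∀ y d, w (y, d) = a y * u d := by
  rw [Submodule.mem_span_range_iff_exists_fun]
  refine exists_congr fun a => ?_
  constructor
  · rintro rfl y d
    simp [blockVec, Finset.sum_apply]
  · intro h
    ext ⟨y, d⟩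
    simp [blockVec, Finset.sum_apply, h]

/-- The subspaces `V_j` spanned by the block vectors of the common eigenvectors are
invariant under the lifted matrix, each has dimension `m`, they are independent, and the
whole space is their internal direct sum. -/
theorem liftedMatrix_invariant_subspaces (m n : ℕ) (hm : 1 ≤ m) (hn : 1 ≤ n)
    (A : Matrix (Fin m) (Fin m) ℂ) (B : Fin m → Matrix (Fin n) (Fin n) ℂ)
    (U : Matrix (Fin n) (Fin n) ℂ) (hU : IsUnit U.det)
    (lam : Fin m → Fin n → ℂ)
    (hB : ∀ (x : Fin m) (j : Fin n),
      (B x).mulVec (fun d => U d j) = lam x j • fun d => U d j) :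
    ∀ V : Fin n → Submodule ℂ (Fin m × Fin n → ℂ),
      (∀ j, V j = Submodule.span ℂ (Set.range fun x : Fin m => blockVec (fun d => U d j) x)) →
      (∀ j, ∀ w ∈ V j, (liftedMatrix A B).mulVec w ∈ V j) ∧
      (∀ j, Module.finrank ℂ (V j) = m) ∧
      iSupIndep V ∧
      DirectSum.IsInternal V := by
  intro V hV
  have hdet : U.det ≠ 0 := hU.ne_zero
  have hmem : ∀ j w, w ∈ V j ↔ ∃ a : Fin m → ℂ, ∀ y d, w (y, d) = a y * U d j := by
    intro j w
    rw [hV j]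
    exact mem_span_blockVec_iff (fun d => U d j) w
  have hind : iSupIndep V := by
    rw [iSupIndep_iff_finsetSum_eq_zero_imp_eq_zero]
    intro s v hv hsum
    have h1 : ∀ j, ∃ a : Fin m → ℂ, j ∈ s → ∀ y d, v j (y, d) = a y * U d j := by
      intro j
      by_cases hj : j ∈ s
      · obtain ⟨a, ha⟩ := (hmem j _).1 (hv j hj)
        exact ⟨a, fun _ => ha⟩
      · exact ⟨0, fun h => absurd h hj⟩
    choose a ha using h1
    intro j hj
    ext ⟨y, d⟩
    have h2 : U.mulVec (fun j => if j ∈ s then a j y else 0) = 0 := by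
      ext d
      have h3 := congrFun hsum (y, d)
      rw [Finset.sum_apply] at h3
      rw [Finset.sum_congr rfl (fun j hj => ha j hj y d)] at h3
      simp only [Matrix.mulVec, dotProduct, mul_ite, mul_zero, Finset.sum_ite_mem,
        Finset.univ_inter]
      simpa [mul_comm] using h3
    have h4 := congrFun (Matrix.eq_zero_of_mulVec_eq_zero hdet h2) j
    simp only [hj, if_true, Pi.zero_apply] at h4
    simp [ha j hj, h4]
  have htop : iSup V = ⊤ := by
    rw [eq_top_iff]
    intro w _
    have hw : w = ∑ j, fun p : Fin m × Fin n =>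
        (U⁻¹.mulVec fun d => w (p.1, d)) j * U p.2 j := by
      ext ⟨y, d⟩
      have h5 : U.mulVec (U⁻¹.mulVec fun d => w (y, d)) = fun d => w (y, d) := by
        rw [Matrix.mulVec_mulVec, Matrix.mul_nonsing_inv U hU, Matrix.one_mulVec]
      have h6 := congrFun h5 d
      rw [Finset.sum_apply, ← h6, Matrix.mulVec, dotProduct]
      exact Finset.sum_congr rfl fun j _ => mul_comm _ _
    rw [hw]
    refine Submodule.sum_mem _ fun j _ => Submodule.mem_iSup_of_mem j ?_
    exact (hmem j _).2 ⟨fun y => (U⁻¹.mulVec fun d => w (y, d)) j, fun y d => rfl⟩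
  refine ⟨?_, ?_, hind, DirectSum.isInternal_submodule_of_iSupIndep_of_iSup_eq_top hind htop⟩
  · intro j w hw
    obtain ⟨a, ha⟩ := (hmem j w).1 hw
    refine (hmem j _).2 ⟨fun y => A.mulVec a y + lam y j * a y, fun y d => ?_⟩
    have hb := congrFun (hB y j) d
    simp only [Matrix.mulVec, dotProduct, Pi.smul_apply, smul_eq_mul] at hb
    simp only [Matrix.mulVec, dotProduct, liftedMatrix, Matrix.of_apply, Fintype.sum_prod_type,
      ha, add_mul, ite_mul, zero_mul, Finset.sum_add_distrib, Finset.sum_ite_eq,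
      Finset.mem_univ, if_true]
    congr 1
    · rw [Finset.sum_mul]
      exact Finset.sum_congr rfl fun x _ => by ring
    · rw [Finset.sum_comm]
      simp only [Finset.sum_ite_eq, Finset.mem_univ, if_true]
      rw [mul_right_comm, ← hb, Finset.sum_mul]
      exact Finset.sum_congr rfl fun x _ => by ring
  · intro j
    have hne : ∃ d, U d j ≠ 0 := by
      by_contra! h
      exact hdet (Matrix.det_eq_zero_of_column_eq_zero j h)
    obtain ⟨d, hd⟩ := hne
    have hli : LinearIndependent ℂ (fun x : Fin m => blockVec (fun d => U d j) x) := by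
      rw [Fintype.linearIndependent_iff]
      intro g hg x
      have := congrFun hg (x, d)
      simpa [blockVec, Finset.sum_apply, hd] using this
    rw [hV j, finrank_span_eq_card hli, Fintype.card_fin]
end

section
/- Let m, n ≥ 1, let A ∈ ℂ^{m×m}, let B^{(x)} ∈ ℂ^{n×n} for x ∈ Fin m, and let U ∈ ℂ^{n×n} be an invertible matrix whose columns u_j satisfy B^{(x)} u_j = λ^{(x)}_j u_j for all x, j. Let à be the lifted matrix Ã((x,c),(y,d)) = δ_{c,d}·A_{x,y} + δ_{x,y}·B^{(x)}_{c,d}, and let F be the matrix indexed by (Fin m × Fin n) × (Fin m × Fin n) with entries F((x,c),(y,j)) = δ_{x,y}·U_{c,j}. Then F is invertible and F⁻¹·Ã·F is block-diagonal in the second index: for all x, y ∈ Fin m and j, l ∈ Fin n, (F⁻¹·Ã·F)((x,j),(y,l)) = δ_{j,l}·(A_{x,y} + δ_{x,y}·λ^{(x)}_j); that is, the (j,j)-block equals A + Θ^{(j)}, where Θ^{(j)} is the diagonal m×m matrix with entries λ^{(x)}_j. -/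
open scoped BigOperators

/-- The transition matrix `F((x,c),(y,j)) = δ_{x,y}·U_{c,j}` built from the common
eigenvector matrix `U`. -/
def transitionMatrix {m n : ℕ} (U : Matrix (Fin n) (Fin n) ℂ) :
    Matrix (Fin m × Fin n) (Fin m × Fin n) ℂ :=
  Matrix.of fun p q => if p.1 = q.1 then U p.2 q.2 else 0

/-- The transition matrix `F` is invertible and conjugation by `F` brings the lifted
matrix to block-diagonal form with blocks `A + Θ^{(j)}`. -/
theorem liftedMatrix_blockDiagonalization (m n : ℕ) (hm : 1 ≤ m) (hn : 1 ≤ n)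
    (A : Matrix (Fin m) (Fin m) ℂ) (B : Fin m → Matrix (Fin n) (Fin n) ℂ)
    (U : Matrix (Fin n) (Fin n) ℂ) (hU : IsUnit U.det)
    (lam : Fin m → Fin n → ℂ)
    (hB : ∀ (x : Fin m) (j : Fin n),
      (B x).mulVec (fun d => U d j) = lam x j • fun d => U d j) :
    IsUnit (transitionMatrix (m := m) U).det ∧
    ∀ (x y : Fin m) (j l : Fin n),
      ((transitionMatrix (m := m) U)⁻¹ * liftedMatrix A B * transitionMatrix (m := m) U)
          (x, j) (y, l) =
        if j = l then A x y + (if x = y then lam x j else 0) else 0 := by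
  have hF : transitionMatrix (m := m) U * transitionMatrix (m := m) U⁻¹ = 1 := by
    ext ⟨x, c⟩ ⟨y, d⟩
    have h := congrFun (congrFun (Matrix.mul_nonsing_inv U hU) c) d
    rw [Matrix.mul_apply] at h
    simp only [Matrix.mul_apply, transitionMatrix, Matrix.of_apply, Fintype.sum_prod_type,
      Matrix.one_apply, Prod.mk.injEq] at h ⊢
    by_cases hxy : x = y
    · subst hxy
      simp [Finset.sum_ite_irrel, ite_mul, h]
    · simp [ite_mul, Finset.sum_ite_irrel, hxy]
  have hdet : IsUnit (transitionMatrix (m := m) U).det :=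
    Matrix.isUnit_det_of_right_inverse hF
  refine ⟨hdet, ?_⟩
  let D : Matrix (Fin m × Fin n) (Fin m × Fin n) ℂ := Matrix.of fun p q =>
    if p.2 = q.2 then A p.1 q.1 + (if p.1 = q.1 then lam p.1 p.2 else 0) else 0
  have key : liftedMatrix A B * transitionMatrix (m := m) U
      = transitionMatrix (m := m) U * D := by
    ext ⟨x, c⟩ ⟨y, l⟩
    have h := congrFun (hB x l) c
    simp only [Matrix.mulVec, dotProduct, Pi.smul_apply, smul_eq_mul] at h
    simp only [Matrix.mul_apply, transitionMatrix, liftedMatrix, D, Matrix.of_apply,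
      Fintype.sum_prod_type]
    have e1 : ∀ f : Fin m → Fin n → ℂ,
        (∑ z, ∑ d, f z d * (if z = y then U d l else 0)) = ∑ d, f y d * U d l := by
      intro f
      rw [Finset.sum_eq_single y]
      · simp
      · intro b _ hb
        simp [hb]
      · simp
    have e2 : ∀ f : Fin m → Fin n → ℂ,
        (∑ z, ∑ d, (if x = z then U c d else 0) * f z d) = ∑ d, U c d * f x d := by
      intro f
      rw [Finset.sum_eq_single x]
      · simp
      · intro b _ hb
        simp [hb.symm]
      · simp
    rw [e1 (fun z d => (if c = d then A x z else 0) + (if x = z then B x c d else 0)),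
      e2 (fun z d => if d = l then A z y + (if z = y then lam z d else 0) else 0)]
    by_cases hxy : x = y
    · subst hxy
      simp [add_mul, Finset.sum_add_distrib, h]
      ring
    · simp [hxy, mul_comm]
  intro x y j l
  rw [Matrix.mul_assoc, key, ← Matrix.mul_assoc, Matrix.nonsing_inv_mul _ hdet, Matrix.one_mul]
  rfl
end

section
/- Let m, n ≥ 1, let A ∈ ℂ^{m×m}, let B^{(x)} ∈ ℂ^{n×n} for x ∈ Fin m, and let U ∈ ℂ^{n×n} be an invertible matrix whose columns u_j satisfy B^{(x)} u_j = λ^{(x)}_j u_j for all x, j. Let à be the lifted matrix Ã((x,c),(y,d)) = δ_{c,d}·A_{x,y} + δ_{x,y}·B^{(x)}_{c,d}. Then the spectrum of à (as a ℂ-matrix) equals the union over j ∈ Fin n of the spectra of the m×m matrices A + Θ^{(j)}, where Θ^{(j)} is the diagonal matrix with entries λ^{(x)}_j. -/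
open scoped BigOperators

/-- The spectrum of the lifted matrix is the union over `j` of the spectra of the
`m×m` matrices `A + Θ^{(j)}`, where `Θ^{(j)}` is diagonal with entries `λ^{(x)}_j`. -/
theorem liftedMatrix_spectrum (m n : ℕ) (hm : 1 ≤ m) (hn : 1 ≤ n)
    (A : Matrix (Fin m) (Fin m) ℂ) (B : Fin m → Matrix (Fin n) (Fin n) ℂ)
    (U : Matrix (Fin n) (Fin n) ℂ) (hU : IsUnit U.det)
    (lam : Fin m → Fin n → ℂ)
    (hB : ∀ (x : Fin m) (j : Fin n),
      (B x).mulVec (fun d => U d j) = lam x j • fun d => U d j) :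
    spectrum ℂ (liftedMatrix A B) =
      ⋃ j : Fin n, spectrum ℂ (A + Matrix.diagonal fun x => lam x j) := by
  classical
  set V : Matrix (Fin m × Fin n) (Fin m × Fin n) ℂ :=
    Matrix.of fun p q => if p.1 = q.1 then U p.2 q.2 else 0 with hV
  set D : Matrix (Fin m × Fin n) (Fin m × Fin n) ℂ :=
    Matrix.blockDiagonal fun j : Fin n => A + Matrix.diagonal fun x => lam x j with hD
  have hVdet : V.det ≠ 0 := by
    have hk : V = Matrix.kroneckerMap (fun a b => a * b) (1 : Matrix (Fin m) (Fin m) ℂ) U := by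
      ext p q
      simp [hV, Matrix.one_apply]
    have h2 := Matrix.det_kronecker (1 : Matrix (Fin m) (Fin m) ℂ) U
    rw [hk, h2]
    simp [hU.ne_zero]
  have key : liftedMatrix A B * V = V * D := by
    ext ⟨x, c⟩ ⟨y, j⟩
    have h := congrFun (hB x j) c
    simp only [Matrix.mulVec, dotProduct, Pi.smul_apply, smul_eq_mul] at h
    simp only [Matrix.mul_apply, Fintype.sum_prod_type, liftedMatrix, hV, hD, Matrix.of_apply,
      Matrix.blockDiagonal_apply, Matrix.add_apply, Matrix.diagonal_apply]
    have e1 : ∀ z : Fin m, (∑ d : Fin n, ((if c = d then A x z else 0) +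
        if x = z then B x c d else 0) * (if z = y then U d j else 0))
        = if z = y then A x z * U c j + (if x = z then lam x j * U c j else 0) else 0 := by
      intro z
      by_cases hz : z = y
      · subst hz
        by_cases hx : x = z
        · subst hx
          simp [add_mul, Finset.sum_add_distrib, h]
        · simp [hx]
      · simp [hz]
    rw [Finset.sum_congr rfl fun z _ => e1 z]
    have e3 : ∀ z : Fin m, (∑ d : Fin n, (if x = z then U c d else 0) *
        (if d = j then A z y + (if z = y then lam z d else 0) else 0))
        = if x = z then U c j * (A z y + if z = y then lam z j else 0) else 0 := by
      intro z
      by_cases hx : x = z <;> simp [hx]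
    rw [Finset.sum_congr rfl fun z _ => e3 z]
    simp only [Finset.sum_ite_eq, Finset.sum_ite_eq', Finset.mem_univ, if_true]
    split_ifs <;> ring
  ext z
  simp only [Set.mem_iUnion, spectrum.mem_iff, Matrix.isUnit_iff_isUnit_det, isUnit_iff_ne_zero,
    not_not]
  have hmul : (algebraMap ℂ _ z - liftedMatrix A B) * V = V * (algebraMap ℂ _ z - D) := by
    rw [sub_mul, mul_sub, key, Algebra.commutes]
  have hdet : (algebraMap ℂ _ z - liftedMatrix A B).det = (algebraMap ℂ _ z - D).det := by
    have := congrArg Matrix.det hmul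
    rw [Matrix.det_mul, Matrix.det_mul, mul_comm] at this
    exact mul_left_cancel₀ hVdet this
  have hblock : algebraMap ℂ _ z - D = Matrix.blockDiagonal fun j : Fin n =>
      algebraMap ℂ (Matrix (Fin m) (Fin m) ℂ) z - (A + Matrix.diagonal fun x => lam x j) := by
    ext ⟨x, c⟩ ⟨y, j⟩
    by_cases hc : c = j <;>
      simp [hD, Matrix.blockDiagonal_apply, Matrix.algebraMap_matrix_apply, hc]
  rw [hdet, hblock, Matrix.det_blockDiagonal, Finset.prod_eq_zero_iff]
  simp
end

section
/- Let m ≥ 1, n ≥ 1, let A ∈ ℂ^{m×m}, and for each x ∈ Fin m let b^{(x)} : ZMod n → ℂ. Let à be the partial-circulant matrix indexed by Fin m × ZMod n with entries Ã((x,c),(y,d)) = δ_{c,d}·A_{x,y} + δ_{x,y}·b^{(x)}_{d-c}, and for k ∈ ZMod n let A_k ∈ ℂ^{m×m} be defined by (A_k)_{x,y} = A_{x,y} + δ_{x,y}·λ_k(b^{(x)}), where λ_k(b^{(x)}) = Σ_{l ∈ ZMod n} b^{(x)}_l·e^{-2πi·k·l/n}. Then for every natural number N and all (x,c), (y,d):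 (Ã^N)((x,c),(y,d)) = (1/n)·Σ_{k ∈ ZMod n} e^{-2πi·k·(c-d)/n}·(A_k^N)(x,y). -/
open scoped BigOperators

/-- The partial-circulant matrix
`Ã((x,c),(y,d)) = δ_{c,d}·A_{x,y} + δ_{x,y}·b^{(x)}_{d-c}`. -/
def partialCirculant {m n : ℕ} (A : Matrix (Fin m) (Fin m) ℂ) (b : Fin m → ZMod n → ℂ) :
    Matrix (Fin m × ZMod n) (Fin m × ZMod n) ℂ :=
  Matrix.of fun p q =>
    (if p.2 = q.2 then A p.1 q.1 else 0) + (if p.1 = q.1 then b p.1 (q.2 - p.2) else 0)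

/-- The `k`-th Fourier eigenvalue `λ_k(b) = Σ_l b_l e^{-2πi·k·l/n}`. -/
noncomputable def fourierEigenvalue (n : ℕ) [NeZero n] (b : ZMod n → ℂ) (k : ZMod n) : ℂ :=
  ∑ l : ZMod n, b l *
    Complex.exp (-(2 * Real.pi * Complex.I * (k.val : ℂ) * (l.val : ℂ)) / (n : ℂ))

/-- The `k`-th block `A_k`, with `(A_k)_{x,y} = A_{x,y} + δ_{x,y}·λ_k(b^{(x)})`. -/
noncomputable def blockOf {m n : ℕ} [NeZero n] (A : Matrix (Fin m) (Fin m) ℂ)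
    (b : Fin m → ZMod n → ℂ) (k : ZMod n) : Matrix (Fin m) (Fin m) ℂ :=
  Matrix.of fun x y => A x y + if x = y then fourierEigenvalue n (b x) k else 0

theorem exp_eq_stdAddChar {n : ℕ} [NeZero n] (k l : ZMod n) :
    Complex.exp (-(2 * Real.pi * Complex.I * (k.val : ℂ) * (l.val : ℂ)) / (n : ℂ)) =
      ZMod.stdAddChar (-(k * l)) := by
  have h : (-(k * l) : ZMod n) = ((-((k.val : ℤ) * (l.val : ℤ)) : ℤ) : ZMod n) := by
    push_cast
    simp
  rw [h, ZMod.stdAddChar_coe]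
  congr 1
  push_cast
  ring

theorem partialCirculant_row {m n : ℕ} [NeZero n]
    (A : Matrix (Fin m) (Fin m) ℂ) (b : Fin m → ZMod n → ℂ) (k c d : ZMod n) (x z : Fin m) :
    ∑ e : ZMod n, partialCirculant A b (x, c) (z, e) * ZMod.stdAddChar (-(k * (e - d))) =
      ZMod.stdAddChar (-(k * (c - d))) * blockOf A b k x z := by
  simp only [partialCirculant, blockOf, Matrix.of_apply, add_mul, Finset.sum_add_distrib, mul_add]
  congr 1
  · simp [ite_mul, mul_comm]
  · by_cases hxz : x = z
    · simp only [hxz, if_true, fourierEigenvalue, exp_eq_stdAddChar, Finset.mul_sum]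
      rw [← Equiv.sum_comp (Equiv.addLeft c)]
      refine Finset.sum_congr rfl fun l _ => ?_
      have h : -(k * (c + l - d)) = -(k * (c - d)) + -(k * l) := by ring
      simp only [Equiv.coe_addLeft, add_sub_cancel_left, h, AddChar.map_add_eq_mul]
      ring
    · simp [hxz]

/-- Powers of a partial-circulant matrix are recovered from the powers of its blocks by
the inverse discrete Fourier transform. -/
theorem partialCirculant_pow_apply (m n : ℕ) (hm : 1 ≤ m) [NeZero n]
    (A : Matrix (Fin m) (Fin m) ℂ) (b : Fin m → ZMod n → ℂ) :
    ∀ (N : ℕ) (x y : Fin m) (c d : ZMod n),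
      (partialCirculant A b ^ N) (x, c) (y, d) =
        (1 / (n : ℂ)) * ∑ k : ZMod n,
          Complex.exp (-(2 * Real.pi * Complex.I * (k.val : ℂ) * (((c - d : ZMod n)).val : ℂ))
              / (n : ℂ)) *
            (blockOf A b k ^ N) x y := by
  intro N
  simp only [exp_eq_stdAddChar]
  induction N with
  | zero =>
    intro x y c d
    have hn : (n : ℂ) ≠ 0 := Nat.cast_ne_zero.mpr (NeZero.ne n)
    have hs := AddChar.sum_mulShift (-(c - d)) (ZMod.isPrimitive_stdAddChar n)
    simp only [pow_zero, ← Finset.sum_mul]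
    have h : ∀ k : ZMod n, -(k * (c - d)) = k * -(c - d) := fun k => by ring
    simp only [h, hs]
    by_cases hcd : c = d <;> by_cases hxy : x = y <;>
      simp [Matrix.one_apply, hcd, hxy, sub_eq_zero, hn, ZMod.card]
    exact fun h => absurd h.symm hcd
  | succ N ih =>
    intro x y c d
    rw [pow_succ', Matrix.mul_apply, Fintype.sum_prod_type]
    simp only [ih, pow_succ', Matrix.mul_apply]
    have h : ∀ k : ZMod n, ZMod.stdAddChar (-(k * (c - d))) *
        ∑ z, blockOf A b k x z * (blockOf A b k ^ N) z y =
        ∑ z, ∑ e : ZMod n, partialCirculant A b (x, c) (z, e) *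
          (ZMod.stdAddChar (-(k * (e - d))) * (blockOf A b k ^ N) z y) := by
      intro k
      rw [Finset.mul_sum]
      refine Finset.sum_congr rfl fun z _ => ?_
      rw [← mul_assoc, ← partialCirculant_row, Finset.sum_mul]
      exact Finset.sum_congr rfl fun e _ => by ring
    simp only [h]
    conv_rhs => rw [Finset.sum_comm, Finset.mul_sum]
    refine Finset.sum_congr rfl fun z _ => ?_
    conv_rhs => rw [Finset.sum_comm, Finset.mul_sum]
    refine Finset.sum_congr rfl fun e _ => ?_
    rw [← Finset.mul_sum]
    ring
end

section
/- For all real numbers s > 0 and F > 0, the following identity holds: −log(s/F) = −(s−F)/F + ∫_{0}^{F} (K−s)⁺·K^{−2} dK + ∫_{F}^{∞} (s−K)⁺·K^{−2} dK, where (x)⁺ = max(x,0), the first integral is over the interval (0,F), the second over (F,∞), and both integrals are finite. -/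
open MeasureTheory

lemma aux_int (a b c : ℝ) (ha : 0 < a) (hab : a ≤ b) :
    ∫ K in a..b, (K - c) * K ^ (-2 : ℤ) = (Real.log b + c / b) - (Real.log a + c / a) := by
  have hpos : ∀ x ∈ Set.uIcc a b, x ≠ 0 := by
    intro x hx
    rw [Set.uIcc_of_le hab] at hx
    exact (lt_of_lt_of_le ha hx.1).ne'
  apply intervalIntegral.integral_eq_sub_of_hasDerivAt (f := fun x => Real.log x + c / x)
  · intro x hx
    have h0 := hpos x hx
    have h := (Real.hasDerivAt_log h0).add ((hasDerivAt_inv h0).const_mul c)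
    convert h using 1
    · funext y
      simp [div_eq_mul_inv]
    · rw [zpow_neg]
      norm_cast
      field_simp
      try ring
  · apply ContinuousOn.intervalIntegrable
    apply ContinuousOn.mul (by fun_prop)
    exact fun x hx => (continuousAt_zpow₀ x _ (Or.inl (hpos x hx))).continuousWithinAt

lemma aux_cont (g : ℝ → ℝ) (hg : Continuous g) (a b : ℝ) (ha : 0 < a) :
    IntegrableOn (fun K : ℝ => g K * K ^ (-2 : ℤ)) (Set.Icc a b) volume := by
  apply ContinuousOn.integrableOn_Icc
  apply ContinuousOn.mul hg.continuousOn
  exact fun x hx => (continuousAt_zpow₀ x _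
    (Or.inl (lt_of_lt_of_le ha hx.1).ne')).continuousWithinAt

/-- Static decomposition of the logarithmic payoff into a linear position, a strip of
puts with strikes below `F`, and a strip of calls with strikes above `F`; both strike
integrals are finite. -/
theorem log_payoff_decomposition (s F : ℝ) (hs : 0 < s) (hF : 0 < F) :
    IntegrableOn (fun K : ℝ => max (K - s) 0 * K ^ (-2 : ℤ)) (Set.Ioo 0 F) volume ∧
    IntegrableOn (fun K : ℝ => max (s - K) 0 * K ^ (-2 : ℤ)) (Set.Ioi F) volume ∧
    -Real.log (s / F) =
      -((s - F) / F) + (∫ K in Set.Ioo 0 F, max (K - s) 0 * K ^ (-2 : ℤ)) +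
        ∫ K in Set.Ioi F, max (s - K) 0 * K ^ (-2 : ℤ) := by
  have z1 : ∀ K, K ≤ s → max (K - s) 0 * K ^ (-2 : ℤ) = 0 := fun K h => by
    rw [max_eq_right (by linarith), zero_mul]
  have z2 : ∀ K, s ≤ K → max (s - K) 0 * K ^ (-2 : ℤ) = 0 := fun K h => by
    rw [max_eq_right (by linarith), zero_mul]
  refine ⟨?_, ?_, ?_⟩
  · have h1 : IntegrableOn (fun K : ℝ => max (K - s) 0 * K ^ (-2 : ℤ)) (Set.Iic s) volume :=
      integrableOn_zero.congr_fun (fun K hK => (z1 K hK).symm) measurableSet_Iic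
    refine (h1.union (aux_cont (fun K => max (K - s) 0) (by fun_prop) s F hs)).mono_set ?_
    intro x hx
    rcases le_total x s with h | h
    · exact Or.inl h
    · exact Or.inr ⟨h, hx.2.le⟩
  · have h1 : IntegrableOn (fun K : ℝ => max (s - K) 0 * K ^ (-2 : ℤ)) (Set.Ici s) volume :=
      integrableOn_zero.congr_fun (fun K hK => (z2 K hK).symm) measurableSet_Ici
    refine (h1.union (aux_cont (fun K => max (s - K) 0) (by fun_prop) F s hF)).mono_set ?_
    intro x hx
    rcases le_total x s with h | h
    · exact Or.inr ⟨le_of_lt hx, h⟩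
    · exact Or.inl h
  · rw [Real.log_div hs.ne' hF.ne']
    rcases le_total s F with h | h
    · have e2 : ∫ K in Set.Ioi F, max (s - K) 0 * K ^ (-2 : ℤ) = 0 :=
        setIntegral_eq_zero_of_forall_eq_zero fun K hK => z2 K (h.trans (le_of_lt hK))
      have e1 : ∫ K in Set.Ioo 0 F, max (K - s) 0 * K ^ (-2 : ℤ)
          = ∫ K in s..F, (K - s) * K ^ (-2 : ℤ) := by
        rw [intervalIntegral.integral_of_le h, integral_Ioc_eq_integral_Ioo]
        rw [setIntegral_eq_of_subset_of_forall_sdiff_eq_zero (s := Set.Ioo s F)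
          measurableSet_Ioo (Set.Ioo_subset_Ioo_left hs.le)]
        · apply setIntegral_congr_fun measurableSet_Ioo
          intro K hK
          simp only [max_eq_left (sub_nonneg.2 hK.1.le)]
        · intro K hK
          apply z1
          by_contra hc
          exact hK.2 ⟨not_le.1 hc, hK.1.2⟩
      rw [e2, e1, aux_int s F s hs h]
      field_simp
      ring
    · have e1 : ∫ K in Set.Ioo 0 F, max (K - s) 0 * K ^ (-2 : ℤ) = 0 :=
        setIntegral_eq_zero_of_forall_eq_zero fun K hK => z1 K (hK.2.le.trans h)
      have e2 : ∫ K in Set.Ioi F, max (s - K) 0 * K ^ (-2 : ℤ)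
          = - ∫ K in F..s, (K - s) * K ^ (-2 : ℤ) := by
        rw [← intervalIntegral.integral_neg, intervalIntegral.integral_of_le h]
        rw [setIntegral_eq_of_subset_of_forall_sdiff_eq_zero (s := Set.Ioc F s)
          measurableSet_Ioi Set.Ioc_subset_Ioi_self]
        · apply setIntegral_congr_fun measurableSet_Ioc
          intro K hK
          simp only [max_eq_left (sub_nonneg.2 hK.2)]
          ring
        · intro K hK
          apply z2
          by_contra hc
          exact hK.2 ⟨hK.1, (not_le.1 hc).le⟩
      rw [e2, e1, aux_int F s s hF h]
      field_simp
      ring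
end

section
/- Let (Ω, ℱ, ℙ) be a probability space and S : Ω → ℝ a random variable with S > 0 almost surely, S integrable with E[S] = F > 0, and log∘S integrable. Then −E[log(S/F)] = ∫_{0}^{F} E[(K−S)⁺]·K^{−2} dK + ∫_{F}^{∞} E[(S−K)⁺]·K^{−2} dK, where both integrals (over (0,F) and (F,∞) respectively, with respect to Lebesgue measure) are finite. -/
open MeasureTheory

lemma lcr_fubini {Ω : Type*} [MeasurableSpace Ω] (P : Measure Ω) [IsProbabilityMeasure P]
    (A : Set ℝ) (f : Ω → ℝ → ℝ) (g : Ω → ℝ)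
    (hm : AEStronglyMeasurable (Function.uncurry f) (P.prod (volume.restrict A)))
    (h0 : ∀ ω K, 0 ≤ f ω K)
    (hi : ∀ᵐ ω ∂P, IntegrableOn (f ω) A volume ∧ ∫ K in A, f ω K = g ω)
    (hg : Integrable g P) :
    IntegrableOn (fun K => ∫ ω, f ω K ∂P) A volume ∧
      ∫ K in A, (∫ ω, f ω K ∂P) = ∫ ω, g ω ∂P := by
  have hI : Integrable (Function.uncurry f) (P.prod (volume.restrict A)) := by
    rw [integrable_prod_iff hm]
    refine ⟨hi.mono fun ω h => h.1, hg.congr ?_⟩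
    filter_upwards [hi] with ω h
    rw [← h.2]
    refine integral_congr_ae (Filter.Eventually.of_forall fun K => ?_)
    simp [Function.uncurry, abs_of_nonneg (h0 ω K)]
  refine ⟨hI.integral_prod_right, ?_⟩
  rw [← integral_integral_swap hI]
  exact integral_congr_ae (hi.mono fun ω h => h.2)

lemma lcr_ftc (a b c : ℝ) (ha : 0 < a) (hab : a ≤ b) :
    IntegrableOn (fun K : ℝ => (c - K) * K ^ (-2 : ℤ)) (Set.Ioo a b) volume ∧
    ∫ K in Set.Ioo a b, (c - K) * K ^ (-2 : ℤ) = c / a - c / b - Real.log b + Real.log a := by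
  have hne : ∀ x ∈ Set.uIcc a b, x ≠ 0 := by
    intro x hx
    rw [Set.uIcc_of_le hab] at hx
    exact (ha.trans_le hx.1).ne'
  have hI : IntervalIntegrable (fun K : ℝ => (c - K) * K ^ (-2 : ℤ)) volume a b := by
    apply ContinuousOn.intervalIntegrable
    exact (continuousOn_const.sub continuousOn_id).mul
      (continuousOn_id.zpow₀ _ fun x hx => Or.inl (hne x hx))
  constructor
  · exact ((intervalIntegrable_iff_integrableOn_Ioc_of_le hab).1 hI).mono_set Set.Ioo_subset_Ioc_self
  · rw [← integral_Ioc_eq_integral_Ioo, ← intervalIntegral.integral_of_le hab,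
      intervalIntegral.integral_eq_sub_of_hasDerivAt
        (f := fun K => - (c * K⁻¹) - Real.log K) _ hI]
    · simp only [div_eq_mul_inv]; ring
    · intro x hx
      have h := hne x hx
      have hd := (((hasDerivAt_inv h).const_mul c).neg).sub (Real.hasDerivAt_log h)
      refine HasDerivAt.congr_deriv hd ?_
      rw [zpow_neg]
      field_simp
      try norm_cast
      try ring

lemma lcr_put (s F : ℝ) (hs : 0 < s) (hF : 0 < F) :
    IntegrableOn (fun K : ℝ => max (K - s) 0 * K ^ (-2 : ℤ)) (Set.Ioo 0 F) volume ∧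
    ∫ K in Set.Ioo 0 F, max (K - s) 0 * K ^ (-2 : ℤ)
      = if s ≤ F then s / F - 1 - Real.log (s / F) else 0 := by
  split_ifs with h
  · have hsub : Set.Ioo s F ⊆ Set.Ioo 0 F := Set.Ioo_subset_Ioo_left hs.le
    have hz : ∀ K ∈ Set.Ioo 0 F \ Set.Ioo s F, max (K - s) 0 * K ^ (-2 : ℤ) = 0 := by
      rintro K ⟨h1, h2⟩
      have : K ≤ s := by
        by_contra! h3
        exact h2 ⟨h3, h1.2⟩
      rw [max_eq_right (by linarith), zero_mul]
    have he : Set.EqOn (fun K : ℝ => -((s - K) * K ^ (-2 : ℤ)))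
        (fun K : ℝ => max (K - s) 0 * K ^ (-2 : ℤ)) (Set.Ioo s F) := by
      intro K hK
      simp only
      rw [max_eq_left (by linarith [hK.1])]; ring
    obtain ⟨h1, h2⟩ := lcr_ftc s F s hs h
    refine ⟨((h1.neg).congr_fun he measurableSet_Ioo).of_forall_sdiff_eq_zero measurableSet_Ioo hz, ?_⟩
    rw [setIntegral_eq_of_subset_of_forall_sdiff_eq_zero measurableSet_Ioo hsub hz,
      ← setIntegral_congr_fun measurableSet_Ioo he, integral_neg, h2,
      Real.log_div hs.ne' hF.ne', div_self hs.ne']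
    ring
  · have he : Set.EqOn (fun K : ℝ => (0 : ℝ))
        (fun K : ℝ => max (K - s) 0 * K ^ (-2 : ℤ)) (Set.Ioo 0 F) := by
      intro K hK
      simp only
      rw [max_eq_right (by linarith [hK.2]), zero_mul]
    refine ⟨integrableOn_zero.congr_fun he measurableSet_Ioo, ?_⟩
    rw [← setIntegral_congr_fun measurableSet_Ioo he]
    simp

lemma lcr_call (s F : ℝ) (hs : 0 < s) (hF : 0 < F) :
    IntegrableOn (fun K : ℝ => max (s - K) 0 * K ^ (-2 : ℤ)) (Set.Ioi F) volume ∧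
    ∫ K in Set.Ioi F, max (s - K) 0 * K ^ (-2 : ℤ)
      = if s ≤ F then 0 else s / F - 1 - Real.log (s / F) := by
  split_ifs with h
  · have he : Set.EqOn (fun K : ℝ => (0 : ℝ))
        (fun K : ℝ => max (s - K) 0 * K ^ (-2 : ℤ)) (Set.Ioi F) := by
      intro K hK
      simp only
      have : F < K := hK
      rw [max_eq_right (by linarith), zero_mul]
    refine ⟨integrableOn_zero.congr_fun he measurableSet_Ioi, ?_⟩
    rw [← setIntegral_congr_fun measurableSet_Ioi he]
    simp
  · push Not at h
    have hsub : Set.Ioo F s ⊆ Set.Ioi F := fun x hx => hx.1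
    have hz : ∀ K ∈ Set.Ioi F \ Set.Ioo F s, max (s - K) 0 * K ^ (-2 : ℤ) = 0 := by
      rintro K ⟨h1, h2⟩
      have : s ≤ K := by
        by_contra! h3
        exact h2 ⟨h1, h3⟩
      rw [max_eq_right (by linarith), zero_mul]
    have he : Set.EqOn (fun K : ℝ => (s - K) * K ^ (-2 : ℤ))
        (fun K : ℝ => max (s - K) 0 * K ^ (-2 : ℤ)) (Set.Ioo F s) := by
      intro K hK
      simp only
      rw [max_eq_left (by linarith [hK.2])]
    obtain ⟨h1, h2⟩ := lcr_ftc F s s hF h.le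
    refine ⟨(h1.congr_fun he measurableSet_Ioo).of_forall_sdiff_eq_zero measurableSet_Ioi hz, ?_⟩
    rw [setIntegral_eq_of_subset_of_forall_sdiff_eq_zero measurableSet_Ioi hsub hz,
      ← setIntegral_congr_fun measurableSet_Ioo he, h2,
      Real.log_div hs.ne' hF.ne', div_self hs.ne']
    ring

/-- The forward value of the log contract equals the value of the static portfolio of
out-of-the-money puts and calls weighted by `K^{-2}`; both strike integrals are finite. -/
theorem log_contract_replication {Ω : Type*} [MeasurableSpace Ω] (ℙ : Measure Ω)
    [IsProbabilityMeasure ℙ] (S : Ω → ℝ) (F : ℝ) (hF : 0 < F)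
    (hpos : ∀ᵐ ω ∂ℙ, 0 < S ω)
    (hint : Integrable S ℙ)
    (hmean : (∫ ω, S ω ∂ℙ) = F)
    (hlog : Integrable (fun ω => Real.log (S ω)) ℙ) :
    IntegrableOn
        (fun K : ℝ => (∫ ω, max (K - S ω) 0 ∂ℙ) * K ^ (-2 : ℤ))
        (Set.Ioo 0 F) volume ∧
    IntegrableOn
        (fun K : ℝ => (∫ ω, max (S ω - K) 0 ∂ℙ) * K ^ (-2 : ℤ))
        (Set.Ioi F) volume ∧
    -(∫ ω, Real.log (S ω / F) ∂ℙ) =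
      (∫ K in Set.Ioo 0 F, (∫ ω, max (K - S ω) 0 ∂ℙ) * K ^ (-2 : ℤ)) +
        ∫ K in Set.Ioi F, (∫ ω, max (S ω - K) 0 ∂ℙ) * K ^ (-2 : ℤ) := by
  have hlogF : Integrable (fun ω => Real.log (S ω / F)) ℙ := by
    refine (hlog.sub (integrable_const (Real.log F))).congr ?_
    filter_upwards [hpos] with ω h
    simp [Real.log_div h.ne' hF.ne']
  have hSF : Integrable (fun ω => S ω / F - 1) ℙ := (hint.div_const F).sub (integrable_const 1)
  have hg : Integrable (fun ω => S ω / F - 1 - Real.log (S ω / F)) ℙ := hSF.sub hlogF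
  have hset : NullMeasurableSet {ω | S ω ≤ F} ℙ :=
    nullMeasurableSet_le hint.aemeasurable aemeasurable_const
  have hg1 : Integrable (fun ω => if S ω ≤ F then S ω / F - 1 - Real.log (S ω / F) else 0) ℙ := by
    refine (hg.indicator₀ hset).congr (Filter.Eventually.of_forall fun ω => ?_)
    simp [Set.indicator_apply]
  have hg2 : Integrable (fun ω => if S ω ≤ F then 0 else S ω / F - 1 - Real.log (S ω / F)) ℙ := by
    refine (hg.indicator₀ hset.compl).congr (Filter.Eventually.of_forall fun ω => ?_)
    by_cases h : S ω ≤ F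
    · simp [Set.indicator_apply, h]
    · simp [Set.indicator_apply, h, not_le.1 h]
  have hK : Measurable fun K : ℝ => K ^ (-2 : ℤ) := by fun_prop
  have hKn : ∀ K : ℝ, 0 ≤ K ^ (-2 : ℤ) := fun K => (even_neg_two).zpow_nonneg K
  have hSm : ∀ A : Set ℝ, AEMeasurable (fun p : Ω × ℝ => S p.1) (ℙ.prod (volume.restrict A)) :=
    fun A => hint.aemeasurable.comp_fst
  obtain ⟨p1, p2⟩ := lcr_fubini ℙ (Set.Ioo 0 F) (fun ω K => max (K - S ω) 0 * K ^ (-2 : ℤ)) _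
    (((measurable_snd.aemeasurable.sub (hSm _)).max aemeasurable_const).mul
      (hK.comp measurable_snd).aemeasurable).aestronglyMeasurable
    (fun ω K => mul_nonneg (le_max_right _ _) (hKn K))
    (hpos.mono fun ω h => lcr_put (S ω) F h hF) hg1
  obtain ⟨c1, c2⟩ := lcr_fubini ℙ (Set.Ioi F) (fun ω K => max (S ω - K) 0 * K ^ (-2 : ℤ)) _
    ((((hSm _).sub measurable_snd.aemeasurable).max aemeasurable_const).mul
      (hK.comp measurable_snd).aemeasurable).aestronglyMeasurable
    (fun ω K => mul_nonneg (le_max_right _ _) (hKn K))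
    (hpos.mono fun ω h => lcr_call (S ω) F h hF) hg2
  simp only [integral_mul_const] at p1 p2 c1 c2
  refine ⟨p1, c1, ?_⟩
  rw [p2, c2, ← integral_add hg1 hg2]
  have : ∀ ω, (if S ω ≤ F then S ω / F - 1 - Real.log (S ω / F) else 0) +
      (if S ω ≤ F then 0 else S ω / F - 1 - Real.log (S ω / F)) =
      S ω / F - 1 - Real.log (S ω / F) := by
    intro ω
    split_ifs <;> simp
  simp only [this]
  rw [integral_sub hSF hlogF, integral_sub (hint.div_const F) (integrable_const 1),
    integral_div, hmean, div_self hF.ne']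
  simp
end
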